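/- arXiv:1707.07349 — 2 statements merged into one kernel-verified Lean document; each statement's English description precedes it below -/
import Mathlib

section
/- Let φ : ℝⁿ × ℝᵐ → ℝ be C² and concave-convex with at least one saddle point, and let z(·) and z′(·) be two trajectories in S. Then the distance |z(t) − z′(t)| is constant in t. -/
open scoped BigOperators

noncomputable section

/-- Points of `ℝⁿ × ℝᵐ`. -/
abbrev Pt (n m : ℕ) := (Fin n → ℝ) × (Fin m → ℝ)

variable {n m : ℕ}

/-- The Euclidean distance on `ℝⁿ × ℝᵐ`. -/
def eDist (a b : Pt n m) : ℝ :=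
  Real.sqrt (∑ i, (a.1 i - b.1 i) ^ 2 + ∑ j, (a.2 j - b.2 j) ^ 2)

/-- The Euclidean inner product on `ℝⁿ × ℝᵐ`. -/
def ip (a b : Pt n m) : ℝ := ∑ i, a.1 i * b.1 i + ∑ j, a.2 j * b.2 j

/-- `φ` is concave-convex: concave in `x` for each fixed `y`, convex in `y` for each fixed `x`. -/
def ConcaveConvex (φ : Pt n m → ℝ) : Prop :=
  (∀ y, ConcaveOn ℝ Set.univ fun x => φ (x, y)) ∧
    (∀ x, ConvexOn ℝ Set.univ fun y => φ (x, y))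

/-- `zb` is a saddle point of `φ`. -/
def IsSaddle (φ : Pt n m → ℝ) (zb : Pt n m) : Prop :=
  ∀ x y, φ (x, zb.2) ≤ φ zb ∧ φ zb ≤ φ (zb.1, y)

/-- The gradient of `φ` in the `x` variables. -/
def gradX (φ : Pt n m → ℝ) (z : Pt n m) : Fin n → ℝ :=
  fun i => fderiv ℝ φ z (Pi.single i 1, 0)

/-- The gradient of `φ` in the `y` variables. -/
def gradY (φ : Pt n m → ℝ) (z : Pt n m) : Fin m → ℝ :=
  fun j => fderiv ℝ φ z (0, Pi.single j 1)

/-- `z : ℝ → ℝⁿ × ℝᵐ` is a (global, C¹) solution of the gradient dynamics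
`ẋ = ∇ₓφ, ẏ = -∇_yφ`. -/
def IsSolution (φ : Pt n m → ℝ) (z : ℝ → Pt n m) : Prop :=
  ∀ t, HasDerivAt z (gradX φ (z t), -gradY φ (z t)) t

/-- `z ∈ 𝒮`: a solution of the gradient dynamics lying at constant distance
from every saddle point. -/
def InS (φ : Pt n m → ℝ) (z : ℝ → Pt n m) : Prop :=
  IsSolution φ z ∧ ∀ zb, IsSaddle φ zb → ∀ t, eDist (z t) zb = eDist (z 0) zb

/-- Second directional derivative of `φ` at `z`, in directions `u` then `v`. -/
def hess (φ : Pt n m → ℝ) (z u v : Pt n m) : ℝ :=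
  fderiv ℝ (fun w => fderiv ℝ φ w u) z v

/-- The `i`th coordinate direction in the `x` variables. -/
def ex (i : Fin n) : Pt n m := (Pi.single i 1, 0)

/-- The `j`th coordinate direction in the `y` variables. -/
def ey (j : Fin m) : Pt n m := (0, Pi.single j 1)

/-- The matrix `A(z) = [[0, φ_{xy}(z)], [-φ_{yx}(z), 0]]`. -/
def matA (φ : Pt n m → ℝ) (z : Pt n m) : Matrix (Fin n ⊕ Fin m) (Fin n ⊕ Fin m) ℝ :=
  Matrix.fromBlocks 0 (Matrix.of fun i j => hess φ z (ex i) (ey j))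
    (Matrix.of fun j i => -hess φ z (ey j) (ex i)) 0

/-- The matrix `B(z) = [[φ_{xx}(z), 0], [0, -φ_{yy}(z)]]`. -/
def matB (φ : Pt n m → ℝ) (z : Pt n m) : Matrix (Fin n ⊕ Fin m) (Fin n ⊕ Fin m) ℝ :=
  Matrix.fromBlocks (Matrix.of fun i i' => hess φ z (ex i) (ex i')) 0 0
    (Matrix.of fun j j' => -hess φ z (ey j) (ey j'))

/-- A point of `ℝⁿ × ℝᵐ` viewed as a vector indexed by `Fin n ⊕ Fin m`. -/
def vec (z : Pt n m) : Fin n ⊕ Fin m → ℝ := Sum.elim z.1 z.2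

/-- A vector indexed by `Fin n ⊕ Fin m` viewed as a point of `ℝⁿ × ℝᵐ`. -/
def unvec (v : Fin n ⊕ Fin m → ℝ) : Pt n m :=
  (fun i => v (Sum.inl i), fun j => v (Sum.inr j))

end

/-- The saddle vector field `(∇ₓφ, -∇_yφ)` at `z`, paired with `v`. -/
noncomputable def saddlePairing {n m : ℕ} (φ : Pt n m → ℝ) (z v : Pt n m) : ℝ :=
  fderiv ℝ φ z (v.1, -v.2)

section

variable {n m : ℕ} {φ : Pt n m → ℝ}

lemma saddlePairing_add (z v w : Pt n m) :
    saddlePairing φ z (v + w) = saddlePairing φ z v + saddlePairing φ z w := by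
  unfold saddlePairing
  rw [← map_add]
  congr 1
  ext <;> simp [add_comm]

lemma saddlePairing_smul (z v : Pt n m) (c : ℝ) :
    saddlePairing φ z (c • v) = c * saddlePairing φ z v := by
  unfold saddlePairing
  rw [← smul_eq_mul, ← map_smul]
  congr 1
  ext <;> simp

lemma saddlePairing_neg (z v : Pt n m) :
    saddlePairing φ z (-v) = -saddlePairing φ z v := by
  simpa using saddlePairing_smul (φ := φ) z v (-1)

lemma saddlePairing_sub (z v w : Pt n m) :
    saddlePairing φ z (v - w) = saddlePairing φ z v - saddlePairing φ z w := by
  rw [sub_eq_add_neg, saddlePairing_add, saddlePairing_neg, ← sub_eq_add_neg]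

lemma sum_grad_eq_saddlePairing (z v : Pt n m) :
    ∑ i, v.1 i * gradX φ z i + ∑ j, v.2 j * -gradY φ z j = saddlePairing φ z v := by
  have hv : ((v.1, -v.2) : Pt n m) =
      ∑ i, v.1 i • ((Pi.single i 1, 0) : Pt n m) + ∑ j, (-v.2 j) • ((0, Pi.single j 1) : Pt n m) := by
    refine Prod.ext ?_ ?_
    · ext k
      simp [Prod.fst_sum, Finset.sum_apply, Pi.single_apply]
    · ext k
      simp [Prod.snd_sum, Finset.sum_apply, Pi.single_apply]
  unfold saddlePairing
  rw [hv, map_add, map_sum, map_sum]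
  simp only [map_smul, smul_eq_mul, gradX, gradY, mul_neg, neg_mul]

lemma ConvexOn.add_fderiv_le {E : Type*} [NormedAddCommGroup E] [NormedSpace ℝ E] {f : E → ℝ}
    (hf : ConvexOn ℝ Set.univ f) {a : E} {f' : E →L[ℝ] ℝ} (hd : HasFDerivAt f f' a) (b : E) :
    f a + f' (b - a) ≤ f b := by
  have hc : ConvexOn ℝ Set.univ (fun s : ℝ => f (AffineMap.lineMap a b s)) :=
    hf.comp_affineMap (AffineMap.lineMap a b)
  have hl : HasDerivAt (fun s : ℝ => f (AffineMap.lineMap a b s)) (f' (b - a)) 0 := by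
    have h1 : HasDerivAt (fun s : ℝ => AffineMap.lineMap a b s) (b - a) 0 :=
      AffineMap.hasDerivAt_lineMap
    have hd' : HasFDerivAt f f' (AffineMap.lineMap a b (0 : ℝ)) := by simpa using hd
    exact hd'.comp_hasDerivAt 0 h1
  have := hc.le_slope_of_hasDerivAt (Set.mem_univ 0) (Set.mem_univ 1) one_pos hl
  simp only [slope_def_field, AffineMap.lineMap_apply_one, AffineMap.lineMap_apply_zero, sub_zero,
    div_one] at this
  linarith

lemma hasFDerivAt_partial_fst (hφ : Differentiable ℝ φ) (z : Pt n m) :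
    HasFDerivAt (fun x => φ (x, z.2))
      ((fderiv ℝ φ z).comp (ContinuousLinearMap.inl ℝ (Fin n → ℝ) (Fin m → ℝ))) z.1 :=
  (hφ z).hasFDerivAt.comp z.1 (hasFDerivAt_prodMk_left z.1 z.2)

lemma hasFDerivAt_partial_snd (hφ : Differentiable ℝ φ) (z : Pt n m) :
    HasFDerivAt (fun y => φ (z.1, y))
      ((fderiv ℝ φ z).comp (ContinuousLinearMap.inr ℝ (Fin n → ℝ) (Fin m → ℝ))) z.2 :=
  (hφ z).hasFDerivAt.comp z.2 (hasFDerivAt_prodMk_right z.1 z.2)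

/-- The saddle vector field of a concave-convex function is monotone (decreasing). -/
lemma ConcaveConvex.saddlePairing_mono (hcc : ConcaveConvex φ) (hφ : Differentiable ℝ φ)
    (a b : Pt n m) : saddlePairing φ a (a - b) ≤ saddlePairing φ b (a - b) := by
  have hx (p : Pt n m) (x : Fin n → ℝ) :
      φ (x, p.2) ≤ φ p + fderiv ℝ φ p (x - p.1, 0) := by
    have := (hcc.1 p.2).neg.add_fderiv_le (hasFDerivAt_partial_fst hφ p).neg x
    simp at this
    linarith
  have hy (p : Pt n m) (y : Fin m → ℝ) :
      φ p + fderiv ℝ φ p (0, y - p.2) ≤ φ (p.1, y) := by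
    simpa using (hcc.2 p.1).add_fderiv_le (hasFDerivAt_partial_snd hφ p) y
  have ha : saddlePairing φ a (a - b) =
      -fderiv ℝ φ a (b.1 - a.1, 0) + fderiv ℝ φ a (0, b.2 - a.2) := by
    rw [saddlePairing, ← map_neg, ← map_add]
    congr 1
    ext <;> simp
  have hb : saddlePairing φ b (a - b) =
      fderiv ℝ φ b (a.1 - b.1, 0) - fderiv ℝ φ b (0, a.2 - b.2) := by
    rw [saddlePairing, ← map_sub]
    congr 1
    ext <;> simp
  have h1 := hx a b.1
  have h2 := hx b a.1
  have h3 := hy a b.2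
  have h4 := hy b a.2
  rw [ha, hb]
  linarith

lemma IsSaddle.fderiv_eq_zero {zb : Pt n m} (h : IsSaddle φ zb) (hφ : Differentiable ℝ φ) :
    fderiv ℝ φ zb = 0 := by
  have h1 := IsLocalMax.hasFDerivAt_eq_zero (f := fun x => φ (x, zb.2)) (a := zb.1)
    (Filter.Eventually.of_forall fun x => (h x zb.2).1) (hasFDerivAt_partial_fst hφ zb)
  have h2 := IsLocalMin.hasFDerivAt_eq_zero (f := fun y => φ (zb.1, y)) (a := zb.2)
    (Filter.Eventually.of_forall fun y => (h zb.1 y).2) (hasFDerivAt_partial_snd hφ zb)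
  exact ContinuousLinearMap.prod_ext h1 h2

lemma IsSaddle.isSolution_const {zb : Pt n m} (h : IsSaddle φ zb) (hφ : Differentiable ℝ φ) :
    IsSolution φ fun _ => zb := by
  intro t
  have : ((gradX φ zb, -gradY φ zb) : Pt n m) = 0 := by
    ext <;> simp [gradX, gradY, h.fderiv_eq_zero hφ]
  rw [this]
  exact hasDerivAt_const t zb

lemma eDist_sq (a b : Pt n m) :
    eDist a b ^ 2 = ∑ i, (a.1 i - b.1 i) ^ 2 + ∑ j, (a.2 j - b.2 j) ^ 2 :=
  Real.sq_sqrt (by positivity)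

lemma IsSolution.hasDerivAt_eDist_sq {z w : ℝ → Pt n m} (hz : IsSolution φ z)
    (hw : IsSolution φ w) (t : ℝ) :
    HasDerivAt (fun t => eDist (z t) (w t) ^ 2)
      (2 * (saddlePairing φ (z t) (z t - w t) - saddlePairing φ (w t) (z t - w t))) t := by
  have hx (i : Fin n) : HasDerivAt (fun t => ((z t).1 i - (w t).1 i) ^ 2)
      (2 * ((z t).1 i - (w t).1 i) * (gradX φ (z t) i - gradX φ (w t) i)) t := by
    have h1 := hasDerivAt_pi.1 (hasFDerivAt_fst.comp_hasDerivAt t (hz t)) i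
    have h2 := hasDerivAt_pi.1 (hasFDerivAt_fst.comp_hasDerivAt t (hw t)) i
    simpa using (h1.fun_sub h2).fun_pow 2
  have hy (j : Fin m) : HasDerivAt (fun t => ((z t).2 j - (w t).2 j) ^ 2)
      (2 * ((z t).2 j - (w t).2 j) * (-gradY φ (z t) j - -gradY φ (w t) j)) t := by
    have h1 := hasDerivAt_pi.1 (hasFDerivAt_snd.comp_hasDerivAt t (hz t)) j
    have h2 := hasDerivAt_pi.1 (hasFDerivAt_snd.comp_hasDerivAt t (hw t)) j
    simpa using (h1.fun_sub h2).fun_pow 2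
  simp only [eDist_sq]
  refine ((HasDerivAt.fun_sum fun i (_ : i ∈ Finset.univ) => hx i).fun_add
    (HasDerivAt.fun_sum fun j (_ : j ∈ Finset.univ) => hy j)).congr_deriv ?_
  simp only [← sum_grad_eq_saddlePairing, mul_sub, Finset.sum_sub_distrib, mul_add,
    Finset.mul_sum, Prod.fst_sub, Prod.snd_sub, Pi.sub_apply, mul_assoc, sub_mul]
  ring

lemma InS.saddlePairing_eq_zero {z : ℝ → Pt n m} (hz : InS φ z) (hφ : Differentiable ℝ φ)
    {zb : Pt n m} (hzb : IsSaddle φ zb) (t : ℝ) : saddlePairing φ (z t) (z t - zb) = 0 := by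
  have h1 := hz.1.hasDerivAt_eDist_sq (hzb.isSolution_const hφ) t
  have h2 : (fun t => eDist (z t) zb ^ 2) = fun _ => eDist (z 0) zb ^ 2 := by
    funext s
    rw [hz.2 zb hzb s]
  rw [h2] at h1
  have h3 := h1.unique (hasDerivAt_const t _)
  have h4 : saddlePairing φ zb (z t - zb) = 0 := by
    simp [saddlePairing, hzb.fderiv_eq_zero hφ]
  linarith

/-- A Minty-type argument: if the saddle field at `zb + w` is orthogonal to `w`, then it is
linear along the segment from the saddle point `zb` to `zb + w`. -/
lemma IsSaddle.saddlePairing_segment {zb w : Pt n m} (hzb : IsSaddle φ zb)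
    (hφ : ContDiff ℝ 2 φ) (hcc : ConcaveConvex φ) (hw : saddlePairing φ (zb + w) w = 0)
    {s : ℝ} (hs : s ∈ Set.Icc (0 : ℝ) 1) (k : Pt n m) :
    saddlePairing φ (zb + s • w) k = s * saddlePairing φ (zb + w) k := by
  have hd : Differentiable ℝ φ := hφ.differentiable (by norm_num)
  have key (h : Pt n m) :
      saddlePairing φ (zb + s • w + h) h ≤ s * saddlePairing φ (zb + w) h := by
    have h1 := hcc.saddlePairing_mono hd (zb + s • w + h) (zb + w)
    have h2 := hcc.saddlePairing_mono hd (zb + s • w + h) zb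
    have e1 : zb + s • w + h - (zb + w) = h - (1 - s) • w := by module
    have e2 : zb + s • w + h - zb = h + s • w := by module
    have h0 : saddlePairing φ zb (h + s • w) = 0 := by
      simp [saddlePairing, hzb.fderiv_eq_zero hd]
    rw [e1] at h1
    rw [e2, h0] at h2
    simp only [saddlePairing_sub, saddlePairing_add, saddlePairing_smul, hw] at h1 h2
    nlinarith [mul_le_mul_of_nonneg_left h1 hs.1,
      mul_le_mul_of_nonneg_left h2 (sub_nonneg.2 hs.2)]
  have le (k : Pt n m) :
      saddlePairing φ (zb + s • w) k ≤ s * saddlePairing φ (zb + w) k := by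
    have hc : Continuous fun ε : ℝ => saddlePairing φ (zb + s • w + ε • k) k := by
      have := hφ.continuous_fderiv (by norm_num)
      unfold saddlePairing
      fun_prop
    have ht : Filter.Tendsto (fun ε : ℝ => saddlePairing φ (zb + s • w + ε • k) k)
        (nhdsWithin 0 (Set.Ioi 0)) (nhds (saddlePairing φ (zb + s • w) k)) := by
      simpa using (hc.tendsto 0).mono_left nhdsWithin_le_nhds
    refine le_of_tendsto ht ?_
    filter_upwards [self_mem_nhdsWithin] with ε (hε : 0 < ε)
    have := key (ε • k)
    rw [saddlePairing_smul, saddlePairing_smul] at this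
    exact le_of_mul_le_mul_left (by linarith) hε
  have h1 := le k
  have h2 := le (-k)
  rw [saddlePairing_neg, saddlePairing_neg] at h2
  linarith

lemma hasDerivAt_saddlePairing (hφ : ContDiff ℝ 2 φ) (zb v k : Pt n m) :
    HasDerivAt (fun s : ℝ => saddlePairing φ (zb + s • v) k)
      (fderiv ℝ (fderiv ℝ φ) zb v (k.1, -k.2)) 0 := by
  have h1 : HasFDerivAt (fderiv ℝ φ) (fderiv ℝ (fderiv ℝ φ) zb) (zb + (0 : ℝ) • v) := by
    rw [zero_smul, add_zero]
    exact ((hφ.fderiv_right (m := 1) (by norm_num)).differentiable (by norm_num) zb).hasFDerivAt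
  have h2 : HasDerivAt (fun s : ℝ => zb + s • v) v 0 := by
    simpa using ((hasDerivAt_id (0 : ℝ)).smul_const v).const_add zb
  exact (ContinuousLinearMap.apply ℝ ℝ ((k.1, -k.2) : Pt n m)).hasFDerivAt.comp_hasDerivAt 0
    (h1.comp_hasDerivAt 0 h2)

/-- If the saddle field at `zb + w` is orthogonal to `w`, it agrees there with the linearization
at the saddle point `zb`. -/
lemma IsSaddle.saddlePairing_eq_linearization {zb w : Pt n m} (hzb : IsSaddle φ zb)
    (hφ : ContDiff ℝ 2 φ) (hcc : ConcaveConvex φ) (hw : saddlePairing φ (zb + w) w = 0)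
    (k : Pt n m) :
    saddlePairing φ (zb + w) k = fderiv ℝ (fderiv ℝ φ) zb w (k.1, -k.2) := by
  have h1 : HasDerivWithinAt (fun s : ℝ => s * saddlePairing φ (zb + w) k)
      (fderiv ℝ (fderiv ℝ φ) zb w (k.1, -k.2)) (Set.Icc 0 1) 0 :=
    (hasDerivAt_saddlePairing hφ zb w k).hasDerivWithinAt.congr
      (fun s hs => (hzb.saddlePairing_segment hφ hcc hw hs k).symm)
      (hzb.saddlePairing_segment hφ hcc hw (by simp) k).symm
  have h2 : HasDerivWithinAt (fun s : ℝ => s * saddlePairing φ (zb + w) k)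
      (saddlePairing φ (zb + w) k) (Set.Icc 0 1) 0 := by
    simpa using ((hasDerivAt_id (0 : ℝ)).mul_const (saddlePairing φ (zb + w) k)).hasDerivWithinAt
  exact (uniqueDiffOn_Icc one_pos 0 (by simp)).eq_deriv _ h2 h1

lemma IsSaddle.linearization_nonpos {zb : Pt n m} (hzb : IsSaddle φ zb)
    (hφ : ContDiff ℝ 2 φ) (hcc : ConcaveConvex φ) (v : Pt n m) :
    fderiv ℝ (fderiv ℝ φ) zb v (v.1, -v.2) ≤ 0 := by
  have hd : Differentiable ℝ φ := hφ.differentiable (by norm_num)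
  have ht := (hasDerivAt_saddlePairing hφ zb v v).tendsto_slope_zero_right
  refine le_of_tendsto ht ?_
  filter_upwards [self_mem_nhdsWithin] with ε (hε : 0 < ε)
  have h0 (u : Pt n m) : saddlePairing φ zb u = 0 := by
    simp [saddlePairing, hzb.fderiv_eq_zero hd]
  have h1 := hcc.saddlePairing_mono hd (zb + ε • v) zb
  rw [h0, add_sub_cancel_left, saddlePairing_smul] at h1
  simp only [zero_add, zero_smul, add_zero, h0, sub_zero, smul_eq_mul]
  exact mul_nonpos_of_nonneg_of_nonpos (inv_pos.2 hε).le (nonpos_of_mul_nonpos_right h1 hε)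

end

/-- Any two trajectories in `𝒮` stay at constant distance from each other. -/
theorem solutions_in_S_constant_distance_apart {n m : ℕ} (φ : Pt n m → ℝ)
    (hφ : ContDiff ℝ 2 φ) (hcc : ConcaveConvex φ)
    (hsaddle : ∃ zb, IsSaddle φ zb)
    (z z' : ℝ → Pt n m) (hz : InS φ z) (hz' : InS φ z') :
    ∀ t : ℝ, eDist (z t) (z' t) = eDist (z 0) (z' 0) := by
  obtain ⟨zb, hzb⟩ := hsaddle
  have hd : Differentiable ℝ φ := hφ.differentiable (by norm_num)
  have hderiv (t : ℝ) : HasDerivAt (fun t => eDist (z t) (z' t) ^ 2) 0 t := by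
    convert hz.1.hasDerivAt_eDist_sq hz'.1 t using 1
    obtain ⟨w, hw⟩ : ∃ w, z t = zb + w := ⟨z t - zb, by abel⟩
    obtain ⟨w', hw'⟩ : ∃ w', z' t = zb + w' := ⟨z' t - zb, by abel⟩
    have h1 := hz.saddlePairing_eq_zero hd hzb t
    have h2 := hz'.saddlePairing_eq_zero hd hzb t
    rw [hw, add_sub_cancel_left] at h1
    rw [hw', add_sub_cancel_left] at h2
    have l1 := hzb.saddlePairing_eq_linearization hφ hcc h1
    have l2 := hzb.saddlePairing_eq_linearization hφ hcc h2
    set D := fderiv ℝ (fderiv ℝ φ) zb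
    have lin (v : Pt n m) : saddlePairing φ (zb + w) v + saddlePairing φ (zb + w') v =
        D (w + w') (v.1, -v.2) := by
      rw [l1, l2, map_add, add_apply]
    have lin' (v : Pt n m) : saddlePairing φ (zb + w) v - saddlePairing φ (zb + w') v =
        D (w - w') (v.1, -v.2) := by
      rw [l1, l2, map_sub, sub_apply]
    have n1 := hzb.linearization_nonpos hφ hcc (w + w')
    have n2 := hzb.linearization_nonpos hφ hcc (w - w')
    rw [← lin] at n1
    rw [← lin'] at n2
    rw [hw, hw', add_sub_add_left_eq_sub]
    simp only [saddlePairing_add, saddlePairing_sub, h1, h2] at n1 n2 ⊢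
    linarith
  intro t
  have hsq : eDist (z t) (z' t) ^ 2 = eDist (z 0) (z' 0) ^ 2 :=
    is_const_of_deriv_eq_zero (fun t => (hderiv t).differentiableAt) (fun t => (hderiv t).deriv) t 0
  exact (pow_left_inj₀ (Real.sqrt_nonneg _) (Real.sqrt_nonneg _) two_ne_zero).1 hsq
end

section
/- Let φ : ℝⁿ × ℝᵐ → ℝ be C² and concave-convex, and assume 0 is a saddle point of φ. Let S_linear be the largest linear subspace of ker(B(0)) that is invariant under A(0) (equivalently, the span of the eigenvectors of A(0) lying in ker(B(0)), taking real and imaginary parts of complex eigenvectors). Then every trajectory z(·) ∈ S satisfies z(t) ∈ S_linear for all t; and if φ is a quadratic function, conversely every solution of the gradient dynamics starting in S_linear belongs to S. -/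
open scoped BigOperators

open Matrix hiding vec
open Topology Filter

section Convexity

variable {E : Type*} [NormedAddCommGroup E] [NormedSpace ℝ E]

/-- A differentiable convex function lies above its tangent planes. -/
lemma ConvexOn.add_hasFDerivAt_le {f : E → ℝ} {f' : E →L[ℝ] ℝ} {a : E}
    (hf : ConvexOn ℝ Set.univ f) (hd : HasFDerivAt f f' a) (b : E) :
    f a + f' (b - a) ≤ f b := by
  have hg : ConvexOn ℝ Set.univ (fun s : ℝ => f (AffineMap.lineMap a b s)) := by
    exact hf.comp_affineMap (AffineMap.lineMap a b)
  have hline : HasDerivAt (fun s : ℝ => f (AffineMap.lineMap a b s)) (f' (b - a)) 0 := by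
    refine HasFDerivAt.comp_hasDerivAt (f := fun s : ℝ => AffineMap.lineMap a b s) 0 ?_
      AffineMap.hasDerivAt_lineMap
    simpa using hd
  have := hg.le_slope_of_hasDerivAt (Set.mem_univ 0) (Set.mem_univ 1) one_pos hline
  simp only [slope_def_field, AffineMap.lineMap_apply_zero, AffineMap.lineMap_apply_one, sub_zero,
    div_one] at this
  linarith

/-- A differentiable concave function lies below its tangent planes. -/
lemma ConcaveOn.le_add_hasFDerivAt {f : E → ℝ} {f' : E →L[ℝ] ℝ} {a : E}
    (hf : ConcaveOn ℝ Set.univ f) (hd : HasFDerivAt f f' a) (b : E) :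
    f b ≤ f a + f' (b - a) := by
  have := hf.neg.add_hasFDerivAt_le hd.neg b
  simp only [Pi.neg_apply, _root_.neg_apply] at this
  linarith

end Convexity

section DotProduct

variable {ι : Type*} [Fintype ι]

lemma HasDerivAt.dotProduct {u w : ℝ → ι → ℝ} {u' w' : ι → ℝ} {t : ℝ}
    (hu : HasDerivAt u u' t) (hw : HasDerivAt w w' t) :
    HasDerivAt (fun s => u s ⬝ᵥ w s) (u' ⬝ᵥ w t + u t ⬝ᵥ w') t := by
  have := HasDerivAt.fun_sum (u := Finset.univ) fun i _ =>
    (hasDerivAt_pi.1 hu i).mul (hasDerivAt_pi.1 hw i)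
  simpa [_root_.dotProduct, Finset.sum_add_distrib] using this

/-- If a continuous dissipative vector field `G` vanishing at `0` is orthogonal to the radial
direction at `v`, then it is linear along the segment from `0` to `v`. -/
lemma map_smul_of_dissipative {G : (ι → ℝ) → ι → ℝ} (hG : Continuous G) (hG0 : G 0 = 0)
    (hdis : ∀ a b, (G a - G b) ⬝ᵥ (a - b) ≤ 0) {v : ι → ℝ} (hv : G v ⬝ᵥ v = 0)
    {r : ℝ} (hr0 : 0 < r) (hr1 : r < 1) : G (r • v) = r • G v := by
  have key (w : ι → ℝ) : (G (r • v) - r • G v) ⬝ᵥ w ≤ 0 := by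
    have hcont : Continuous fun ε : ℝ => (G (r • v + ε • w) - r • G v) ⬝ᵥ w := by
      simp only [_root_.dotProduct, Pi.sub_apply]
      fun_prop
    have hlim : Tendsto (fun ε : ℝ => (G (r • v + ε • w) - r • G v) ⬝ᵥ w) (𝓝[>] 0)
        (𝓝 ((G (r • v) - r • G v) ⬝ᵥ w)) := by
      simpa using (hcont.tendsto 0).mono_left nhdsWithin_le_nhds
    refine le_of_tendsto hlim ?_
    filter_upwards [self_mem_nhdsWithin] with ε (hε : 0 < ε)
    have h1 := hdis (r • v + ε • w) 0
    have h2 := hdis (r • v + ε • w) v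
    simp only [hG0, sub_zero, sub_dotProduct, dotProduct_sub, dotProduct_add, dotProduct_smul,
      smul_dotProduct, smul_eq_mul, hv] at h1 h2 ⊢
    set p := G (r • v + ε • w) ⬝ᵥ w
    set q := G (r • v + ε • w) ⬝ᵥ v
    set s := G v ⬝ᵥ w
    have : ε * (p - r * s) ≤ 0 := by
      nlinarith [mul_le_mul_of_nonneg_left h1 (sub_nonneg.2 hr1.le),
        mul_le_mul_of_nonneg_left h2 hr0.le]
    exact nonpos_of_mul_nonpos_right this hε
  have h := key (G (r • v) - r • G v)
  have h' : (G (r • v) - r • G v) ⬝ᵥ (G (r • v) - r • G v) = 0 :=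
    le_antisymm h (Finset.sum_nonneg fun i _ => mul_self_nonneg _)
  exact sub_eq_zero.1 (dotProduct_self_eq_zero.1 h')

/-- Under the hypotheses of `map_smul_of_dissipative`, the value of the field at `v` is that of
its linearization at `0`. -/
lemma eq_fderiv_zero_of_dissipative {G : (ι → ℝ) → ι → ℝ} (hG : Continuous G) (hG0 : G 0 = 0)
    (hdis : ∀ a b, (G a - G b) ⬝ᵥ (a - b) ≤ 0) {L : (ι → ℝ) →L[ℝ] ι → ℝ}
    (hL : HasFDerivAt G L 0) {v : ι → ℝ} (hv : G v ⬝ᵥ v = 0) : G v = L v := by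
  have hline : HasDerivAt (fun r : ℝ => G (r • v)) (L v) 0 := by
    refine HasFDerivAt.comp_hasDerivAt (f := fun r : ℝ => r • v) 0 (by simpa using hL) ?_
    simpa using (hasDerivAt_id (0 : ℝ)).smul_const v
  have hlim := (hasDerivAt_iff_tendsto_slope.1 hline).mono_left (nhdsGT_le_nhdsNE 0)
  refine tendsto_nhds_unique (tendsto_const_nhds.congr' ?_) hlim
  filter_upwards [Ioo_mem_nhdsGT one_pos] with r hr
  rw [slope_def_module, map_smul_of_dissipative hG hG0 hdis hv hr.1 hr.2]
  simp [hG0, smul_smul, hr.1.ne']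

/-- The linearization at a zero of a dissipative field is negative semidefinite. -/
lemma fderiv_dotProduct_self_nonpos {G : (ι → ℝ) → ι → ℝ} (hG0 : G 0 = 0)
    (hdis : ∀ a b, (G a - G b) ⬝ᵥ (a - b) ≤ 0) {L : (ι → ℝ) →L[ℝ] ι → ℝ}
    (hL : HasFDerivAt G L 0) (v : ι → ℝ) : L v ⬝ᵥ v ≤ 0 := by
  have hline : HasDerivAt (fun r : ℝ => G (r • v)) (L v) 0 := by
    refine HasFDerivAt.comp_hasDerivAt (f := fun r : ℝ => r • v) 0 (by simpa using hL) ?_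
    simpa using (hasDerivAt_id (0 : ℝ)).smul_const v
  have hlim := (hasDerivAt_iff_tendsto_slope.1 hline).mono_left (nhdsGT_le_nhdsNE 0)
  have hdot : Continuous fun w : ι → ℝ => w ⬝ᵥ v := by
    simp only [_root_.dotProduct]
    fun_prop
  refine le_of_tendsto ((hdot.tendsto _).comp hlim) ?_
  filter_upwards [self_mem_nhdsWithin] with r (hr : 0 < r)
  have h := hdis (r • v) 0
  simp only [hG0, sub_zero, dotProduct_smul, smul_eq_mul] at h
  simp only [Function.comp_apply, slope_def_module, zero_smul, hG0, sub_zero, smul_dotProduct,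
    smul_eq_mul]
  exact mul_nonpos_of_nonneg_of_nonpos (inv_nonneg.2 hr.le) (nonpos_of_mul_nonpos_right h hr)

lemma Matrix.dotProduct_mulVec_self_of_transpose_eq_neg {A : Matrix ι ι ℝ} (hA : Aᵀ = -A)
    (v : ι → ℝ) : (A *ᵥ v) ⬝ᵥ v = 0 := by
  have h : (A *ᵥ v) ⬝ᵥ v = -((A *ᵥ v) ⬝ᵥ v) := by
    conv_lhs => rw [dotProduct_comm, dotProduct_mulVec, ← mulVec_transpose, hA, neg_mulVec,
      neg_dotProduct]
  linarith

lemma Matrix.mulVec_eq_zero_of_nonpos {B : Matrix ι ι ℝ} (hB : Bᵀ = B)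
    (hneg : ∀ v, (B *ᵥ v) ⬝ᵥ v ≤ 0) {v : ι → ℝ} (hv : (B *ᵥ v) ⬝ᵥ v = 0) : B *ᵥ v = 0 := by
  have hsymm (w : ι → ℝ) : (B *ᵥ w) ⬝ᵥ v = (B *ᵥ v) ⬝ᵥ w := by
    rw [dotProduct_comm, dotProduct_mulVec, ← mulVec_transpose, hB]
  have hquad (ε : ℝ) : 2 * ε * ((B *ᵥ v) ⬝ᵥ (B *ᵥ v)) +
      ε ^ 2 * ((B *ᵥ (B *ᵥ v)) ⬝ᵥ (B *ᵥ v)) ≤ 0 := by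
    have h := hneg (v + ε • (B *ᵥ v))
    simp only [mulVec_add, mulVec_smul, add_dotProduct, dotProduct_add, dotProduct_smul,
      smul_dotProduct, smul_eq_mul, hv, hsymm] at h
    linarith
  have hnn : 0 ≤ (B *ᵥ v) ⬝ᵥ (B *ᵥ v) := Finset.sum_nonneg fun i _ => mul_self_nonneg _
  rw [← dotProduct_self_eq_zero]
  by_contra hne
  have hpos : 0 < (B *ᵥ v) ⬝ᵥ (B *ᵥ v) := lt_of_le_of_ne hnn (Ne.symm hne)
  set p := (B *ᵥ v) ⬝ᵥ (B *ᵥ v)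
  set q := (B *ᵥ (B *ᵥ v)) ⬝ᵥ (B *ᵥ v)
  have hq : q ≤ 0 := hneg _
  have h := hquad (p / (p - q))
  have hd : 0 < p - q := by linarith
  have hε : 0 < p / (p - q) := div_pos hpos hd
  have hmul : p / (p - q) * (p - q) = p := div_mul_cancel₀ _ hd.ne'
  nlinarith [mul_pos hε hpos, mul_pos hε hε]

end DotProduct

section LinearFlow

variable {E : Type*} [NormedAddCommGroup E] [NormedSpace ℝ E]

lemma exists_hasDerivAt_of_clm [CompleteSpace E] (T : E →L[ℝ] E) (x : E) :
    ∃ w : ℝ → E, w 0 = x ∧ ∀ t, HasDerivAt w (T (w t)) t :=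
  ⟨fun s => NormedSpace.exp (s • T) x, by simp, fun s => by
    simpa using (hasDerivAt_exp_smul_const' (𝕂 := ℝ) T s).clm_apply (hasDerivAt_const s x)⟩

variable [FiniteDimensional ℝ E]

lemma HasDerivAt.mem_of_forall_mem {W : Submodule ℝ E} {u : ℝ → E} {u' : E} {t : ℝ}
    (hu : HasDerivAt u u' t) (hW : ∀ s, u s ∈ W) : u' ∈ W := by
  have h := range_deriv_subset_closure_span_image u (t := Set.univ) dense_univ ⟨t, rfl⟩
  rw [hu.deriv] at h
  have hle : (Submodule.span ℝ (u '' Set.univ) : Set E) ⊆ W :=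
    Submodule.span_le.2 (by rintro _ ⟨s, -, rfl⟩; exact hW s)
  exact closure_minimal hle W.closed_of_finiteDimensional h

/-- An invariant subspace of a linear map is invariant under the corresponding linear flow. -/
lemma mem_of_hasDerivAt_of_invariant {L : E →L[ℝ] E} {W : Submodule ℝ E}
    (hW : ∀ v ∈ W, L v ∈ W) {u : ℝ → E} (hu : ∀ t, HasDerivAt u (L (u t)) t)
    (h0 : u 0 ∈ W) (t : ℝ) : u t ∈ W := by
  have : CompleteSpace W := FiniteDimensional.complete ℝ W
  let T : W →L[ℝ] W := (L.comp W.subtypeL).codRestrict W fun v => hW v v.2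
  obtain ⟨w, hw0, hw⟩ := exists_hasDerivAt_of_clm T ⟨u 0, h0⟩
  have hw' (s : ℝ) : HasDerivAt (fun s => (w s : E)) (L (w s)) s :=
    W.subtypeL.hasFDerivAt.comp_hasDerivAt s (hw s)
  have heq : u = fun s => (w s : E) :=
    ODE_solution_unique_univ (v := fun _ => L) (s := fun _ => Set.univ) (t₀ := 0)
      (fun _ => L.lipschitz.lipschitzOnWith) (fun s => ⟨hu s, trivial⟩)
      (fun s => ⟨hw' s, trivial⟩) (by simp [hw0])
  rw [heq]
  exact (w t).2

end LinearFlow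

section GradientField

variable {n m : ℕ}

@[simp]
lemma unvec_zero : unvec (0 : Fin n ⊕ Fin m → ℝ) = 0 := rfl

lemma eDist_eq_sqrt_dotProduct (a b : Pt n m) :
    eDist a b = Real.sqrt ((vec a - vec b) ⬝ᵥ (vec a - vec b)) := by
  simp [eDist, vec, dotProduct, pow_two]

/-- `unvec` as a continuous linear map. -/
noncomputable def unvecCLM (n m : ℕ) : (Fin n ⊕ Fin m → ℝ) →L[ℝ] Pt n m :=
  LinearMap.toContinuousLinearMap
    { toFun := unvec
      map_add' := fun _ _ => rfl
      map_smul' := fun _ _ => rfl }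

@[simp]
lemma unvecCLM_apply (v : Fin n ⊕ Fin m → ℝ) : unvecCLM n m v = unvec v := rfl

lemma unvec_single_inl (i : Fin n) :
    unvec (Pi.single (Sum.inl i) 1) = (ex i : Pt n m) := by
  ext k <;> simp [unvec, ex, Pi.single_apply]

lemma unvec_single_inr (j : Fin m) :
    unvec (Pi.single (Sum.inr j) 1) = (ey j : Pt n m) := by
  ext k <;> simp [unvec, ey, Pi.single_apply]

/-- The vector field of the gradient dynamics, on vectors indexed by `Fin n ⊕ Fin m`. -/
noncomputable def gradField (φ : Pt n m → ℝ) (v : Fin n ⊕ Fin m → ℝ) : Fin n ⊕ Fin m → ℝ :=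
  vec (gradX φ (unvec v), -gradY φ (unvec v))

lemma isSolution_iff {φ : Pt n m → ℝ} {z : ℝ → Pt n m} :
    IsSolution φ z ↔
      ∀ t, HasDerivAt (fun s => vec (z s)) (gradField φ (vec (z t))) t := by
  refine forall_congr' fun t => ⟨fun h => ?_, fun h => ?_⟩
  · refine hasDerivAt_pi.2 ?_
    rintro (i | j)
    · exact hasDerivAt_pi.1 h.fst i
    · exact hasDerivAt_pi.1 h.snd j
  · exact (unvecCLM n m).hasFDerivAt.comp_hasDerivAt t h

lemma fderiv_apply_eq_sum (φ : Pt n m → ℝ) (z w : Pt n m) :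
    fderiv ℝ φ z w = ∑ i, gradX φ z i * w.1 i + ∑ j, gradY φ z j * w.2 j := by
  have hw : w = ∑ i, w.1 i • (ex i : Pt n m) + ∑ j, w.2 j • (ey j : Pt n m) := by
    ext k <;> simp [ex, ey, Prod.fst_sum, Prod.snd_sum, Finset.sum_apply, Pi.single_apply]
  conv_lhs => rw [hw]
  simp only [map_add, map_sum, map_smul, smul_eq_mul, gradX, gradY, ex, ey, mul_comm]

lemma gradField_dotProduct (φ : Pt n m → ℝ) (v w : Fin n ⊕ Fin m → ℝ) :
    gradField φ v ⬝ᵥ w = fderiv ℝ φ (unvec v) ((unvec w).1, 0) -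
      fderiv ℝ φ (unvec v) (0, (unvec w).2) := by
  simp [fderiv_apply_eq_sum, gradField, vec, unvec, dotProduct, sub_eq_add_neg]

lemma hasFDerivAt_gradField {φ : Pt n m → ℝ} (hφ : ContDiff ℝ 2 φ) (v : Fin n ⊕ Fin m → ℝ) :
    HasFDerivAt (gradField φ)
      (LinearMap.toContinuousLinearMap (matA φ (unvec v) + matB φ (unvec v)).mulVecLin) v := by
  have hd (u : Pt n m) : HasFDerivAt (fun w => fderiv ℝ φ (unvec w) u)
      ((fderiv ℝ (fun w => fderiv ℝ φ w u) (unvec v)).comp (unvecCLM n m)) v := by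
    have hdiff : Differentiable ℝ (fun w => fderiv ℝ φ w u) :=
      (((hφ.fderiv_right (m := 1) (by norm_num)).clm_apply contDiff_const).differentiable
        (by norm_num))
    exact (hdiff (unvec v)).hasFDerivAt.comp v (unvecCLM n m).hasFDerivAt
  refine hasFDerivAt_pi'.2 ?_
  rintro (i | j)
  · refine (hd (ex i)).congr_fderiv ?_
    refine ContinuousLinearMap.coe_injective ((Pi.basisFun ℝ _).ext ?_)
    rintro (k | k) <;>
      simp [unvec_single_inl, unvec_single_inr, matA, matB, hess]
  · refine (hd (ey j)).neg.congr_fderiv ?_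
    refine ContinuousLinearMap.coe_injective ((Pi.basisFun ℝ _).ext ?_)
    rintro (k | k) <;>
      simp [unvec_single_inl, unvec_single_inr, matA, matB, hess]

lemma hess_symm {φ : Pt n m → ℝ} (hφ : ContDiff ℝ 2 φ) (z u v : Pt n m) :
    hess φ z u v = hess φ z v u := by
  have hd : DifferentiableAt ℝ (fderiv ℝ φ) z :=
    (hφ.fderiv_right (m := 1) (by norm_num)).differentiable (by norm_num) z
  have heq (a b : Pt n m) : hess φ z a b = fderiv ℝ (fderiv ℝ φ) z b a := by
    have := (hd.hasFDerivAt.clm_apply (hasFDerivAt_const a z)).fderiv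
    simp [hess, this]
  rw [heq, heq]
  exact (hφ.contDiffAt.isSymmSndFDerivAt (by simp)) v u

lemma transpose_matA {φ : Pt n m → ℝ} (hφ : ContDiff ℝ 2 φ) (z : Pt n m) :
    (matA φ z)ᵀ = -matA φ z := by
  ext (i | i) (j | j) <;> simp [matA, hess_symm hφ z (ey _) (ex _)]

lemma transpose_matB {φ : Pt n m → ℝ} (hφ : ContDiff ℝ 2 φ) (z : Pt n m) :
    (matB φ z)ᵀ = matB φ z := by
  ext (i | i) (j | j)
  · simp [matB, hess_symm hφ z (ex j) (ex i)]
  · simp [matB]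
  · simp [matB]
  · simp [matB, hess_symm hφ z (ey j) (ey i)]

lemma gradField_dissipative {φ : Pt n m → ℝ} (hφ : ContDiff ℝ 2 φ) (hcc : ConcaveConvex φ)
    (a b : Fin n ⊕ Fin m → ℝ) : (gradField φ a - gradField φ b) ⬝ᵥ (a - b) ≤ 0 := by
  have hd (z : Pt n m) : HasFDerivAt φ (fderiv ℝ φ z) z :=
    (hφ.differentiable (by norm_num) z).hasFDerivAt
  have hx (z : Pt n m) (x : Fin n → ℝ) :
      φ (x, z.2) ≤ φ z + fderiv ℝ φ z (x - z.1, 0) :=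
    (hcc.1 z.2).le_add_hasFDerivAt ((hd z).comp z.1 (hasFDerivAt_prodMk_left z.1 z.2)) x
  have hy (z : Pt n m) (y : Fin m → ℝ) :
      φ z + fderiv ℝ φ z (0, y - z.2) ≤ φ (z.1, y) :=
    (hcc.2 z.1).add_hasFDerivAt_le ((hd z).comp z.2 (hasFDerivAt_prodMk_right z.1 z.2)) y
  have h1 := hx (unvec a) (unvec b).1
  have h2 := hx (unvec b) (unvec a).1
  have h3 := hy (unvec a) (unvec b).2
  have h4 := hy (unvec b) (unvec a).2
  rw [← neg_sub b a, dotProduct_neg, sub_dotProduct, gradField_dotProduct, gradField_dotProduct]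
  have h5 : (unvec (b - a)).1 = (unvec b).1 - (unvec a).1 := rfl
  have h6 : (unvec (b - a)).2 = (unvec b).2 - (unvec a).2 := rfl
  have h7 : fderiv ℝ φ (unvec b) ((unvec a).1 - (unvec b).1, 0) =
      -fderiv ℝ φ (unvec b) ((unvec b).1 - (unvec a).1, 0) := by
    rw [← map_neg]; simp
  have h8 : fderiv ℝ φ (unvec b) (0, (unvec a).2 - (unvec b).2) =
      -fderiv ℝ φ (unvec b) (0, (unvec b).2 - (unvec a).2) := by
    rw [← map_neg]; simp
  rw [h5, h6]
  rw [h7] at h2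
  rw [h8] at h4
  linarith

lemma IsSaddle.gradField_eq_zero {φ : Pt n m → ℝ} (hφ : ContDiff ℝ 2 φ) {z : Pt n m}
    (hz : IsSaddle φ z) : gradField φ (vec z) = 0 := by
  have hd : HasFDerivAt φ (fderiv ℝ φ z) z :=
    (hφ.differentiable (by norm_num) z).hasFDerivAt
  have hx := IsLocalMax.hasFDerivAt_eq_zero (f := fun x => φ (x, z.2)) (a := z.1)
    (Eventually.of_forall fun x => (hz x z.2).1)
    (hd.comp z.1 (hasFDerivAt_prodMk_left z.1 z.2))
  have hy := IsLocalMin.hasFDerivAt_eq_zero (f := fun y => φ (z.1, y)) (a := z.2)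
    (Eventually.of_forall fun y => (hz z.1 y).2)
    (hd.comp z.2 (hasFDerivAt_prodMk_right z.1 z.2))
  ext (i | j)
  · simpa [gradField, vec, unvec, gradX] using DFunLike.congr_fun hx (Pi.single i 1)
  · simpa [gradField, vec, unvec, gradY] using congrArg Neg.neg (DFunLike.congr_fun hy (Pi.single j 1))

end GradientField


/-- Theorem 2 of the paper. Assume `0` is a saddle point of the `C²`
concave-convex `φ`, and let `Slin` be the largest linear subspace of `ker B(0)` invariant
under `A(0)`. Then every trajectory in `𝒮` stays in `Slin`; and if `φ` is quadratic (has
constant Hessian), every solution of the gradient dynamics starting in `Slin` is in `𝒮`. -/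
theorem S_inside_S_linear {n m : ℕ} (φ : Pt n m → ℝ)
    (hφ : ContDiff ℝ 2 φ) (hcc : ConcaveConvex φ)
    (h0 : IsSaddle φ (0 : Pt n m))
    (Slin : Submodule ℝ (Fin n ⊕ Fin m → ℝ))
    (hker : ∀ v ∈ Slin, (matB φ 0).mulVec v = 0)
    (hinv : ∀ v ∈ Slin, (matA φ 0).mulVec v ∈ Slin)
    (hmax : ∀ W : Submodule ℝ (Fin n ⊕ Fin m → ℝ),
      (∀ v ∈ W, (matB φ 0).mulVec v = 0) → (∀ v ∈ W, (matA φ 0).mulVec v ∈ W) →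
      W ≤ Slin) :
    (∀ z : ℝ → Pt n m, InS φ z → ∀ t, vec (z t) ∈ Slin) ∧
    ((∀ (w u v : Pt n m), hess φ w u v = hess φ 0 u v) →
      ∀ z : ℝ → Pt n m, IsSolution φ z → vec (z 0) ∈ Slin → InS φ z) := by
  have hF0 : gradField φ 0 = 0 := h0.gradField_eq_zero hφ
  have hdis := gradField_dissipative hφ hcc
  have hskew := Matrix.dotProduct_mulVec_self_of_transpose_eq_neg (transpose_matA hφ 0)
  have hL := hasFDerivAt_gradField hφ 0
  refine ⟨fun z hz => ?_, fun hquad z hz hz0 => ?_⟩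
  · have hsol := isSolution_iff.1 hz.1
    have horth (t : ℝ) : gradField φ (vec (z t)) ⬝ᵥ vec (z t) = 0 := by
      have hconst : (fun s => vec (z s) ⬝ᵥ vec (z s)) = fun _ => vec (z 0) ⬝ᵥ vec (z 0) := by
        ext s
        have hv0 : vec (0 : Pt n m) = 0 := by ext (i | j) <;> rfl
        have h := hz.2 0 h0 s
        rw [eDist_eq_sqrt_dotProduct, eDist_eq_sqrt_dotProduct, hv0, sub_zero, sub_zero] at h
        exact (Real.sqrt_inj (Finset.sum_nonneg fun i _ => mul_self_nonneg _)
          (Finset.sum_nonneg fun i _ => mul_self_nonneg _)).1 h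
      have hderiv := (hsol t).dotProduct (hsol t)
      rw [hconst] at hderiv
      have := hderiv.unique (hasDerivAt_const t _)
      rw [dotProduct_comm (vec (z t))] at this
      linarith
    have hlin (t : ℝ) : gradField φ (vec (z t)) =
        matA φ 0 *ᵥ vec (z t) + matB φ 0 *ᵥ vec (z t) := by
      rw [eq_fderiv_zero_of_dissipative (continuous_iff_continuousAt.2 fun v =>
        (hasFDerivAt_gradField hφ v).continuousAt) hF0 hdis hL (horth t)]
      simp
    have hneg (v : Fin n ⊕ Fin m → ℝ) : (matB φ 0 *ᵥ v) ⬝ᵥ v ≤ 0 := by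
      have := fderiv_dotProduct_self_nonpos hF0 hdis hL v
      simpa [add_mulVec, add_dotProduct, hskew] using this
    have hB (t : ℝ) : matB φ 0 *ᵥ vec (z t) = 0 := by
      refine Matrix.mulVec_eq_zero_of_nonpos (transpose_matB hφ 0) hneg ?_
      have := horth t
      rwa [hlin, add_dotProduct, hskew, zero_add] at this
    let W := Submodule.span ℝ (Set.range fun s => vec (z s))
    have hW (s : ℝ) : vec (z s) ∈ W := Submodule.subset_span ⟨s, rfl⟩
    have hWA : W ≤ W.comap (matA φ 0).mulVecLin := by
      refine Submodule.span_le.2 ?_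
      rintro _ ⟨t, rfl⟩
      have := (hsol t).mem_of_forall_mem hW
      simpa [hlin, hB] using this
    have hWB : W ≤ LinearMap.ker (matB φ 0).mulVecLin := by
      refine Submodule.span_le.2 ?_
      rintro _ ⟨t, rfl⟩
      simpa using hB t
    exact fun t => hmax W (fun v hv => by simpa using hWB hv) (fun v hv => hWA hv) (hW t)
  · have hF (v : Fin n ⊕ Fin m → ℝ) :
        gradField φ v = matA φ 0 *ᵥ v + matB φ 0 *ᵥ v := by
      set L : (Fin n ⊕ Fin m → ℝ) →L[ℝ] Fin n ⊕ Fin m → ℝ :=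
        LinearMap.toContinuousLinearMap (matA φ 0 + matB φ 0).mulVecLin with hLdef
      have hd (w : Fin n ⊕ Fin m → ℝ) :
          HasFDerivAt (𝕜 := ℝ) (fun w => gradField φ w - L w) 0 w := by
        have h := (hasFDerivAt_gradField hφ w).sub L.hasFDerivAt
        have hA : matA φ (unvec w) = matA φ 0 := by simp only [matA, hquad (unvec w)]
        have hB : matB φ (unvec w) = matB φ 0 := by simp only [matB, hquad (unvec w)]
        rwa [hA, hB, ← hLdef, sub_self] at h
      have hconst := is_const_of_fderiv_eq_zero (𝕜 := ℝ)
        (f := fun w => gradField φ w - L w)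
        (fun w => (hd w).differentiableAt) (fun w => (hd w).fderiv) v 0
      simp only [hF0, map_zero, sub_zero] at hconst
      rw [sub_eq_zero.1 hconst]
      simp [L]
    have hsol := isSolution_iff.1 hz
    have hmem (t : ℝ) : vec (z t) ∈ Slin := by
      refine mem_of_hasDerivAt_of_invariant
        (L := LinearMap.toContinuousLinearMap (matA φ 0 + matB φ 0).mulVecLin)
        (u := fun s => vec (z s)) (fun v hv => ?_) (fun s => ?_) hz0 t
      · simpa [add_mulVec, hker v hv] using hinv v hv
      · simpa [add_mulVec, hF] using hsol s
    refine ⟨hz, fun zb hzb t => ?_⟩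
    have hbz : matA φ 0 *ᵥ vec zb = -(matB φ 0 *ᵥ vec zb) := by
      rw [eq_neg_iff_add_eq_zero, ← hF]
      exact hzb.gradField_eq_zero hφ
    have hderiv (s : ℝ) : HasDerivAt
        (fun s => (vec (z s) - vec zb) ⬝ᵥ (vec (z s) - vec zb)) 0 s := by
      have hs := (hsol s).sub_const (vec zb)
      convert hs.dotProduct hs using 1
      have hcross : (matA φ 0 *ᵥ vec (z s)) ⬝ᵥ vec zb = 0 := by
        rw [dotProduct_comm, dotProduct_mulVec, ← mulVec_transpose, transpose_matA hφ, neg_mulVec,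
          hbz, neg_neg, dotProduct_comm, dotProduct_mulVec, ← mulVec_transpose, transpose_matB hφ,
          hker _ (hmem s), zero_dotProduct]
      rw [dotProduct_comm (vec (z s) - vec zb), hF, hker _ (hmem s), add_zero, dotProduct_sub,
        hskew, hcross]
      simp
    rw [eDist_eq_sqrt_dotProduct, eDist_eq_sqrt_dotProduct]
    congr 1
    exact is_const_of_deriv_eq_zero (fun s => (hderiv s).differentiableAt)
      (fun s => (hderiv s).deriv) t 0
end
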